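/- Let C be a 3-uniform clutter on [n] that can be transformed to the empty clutter by a finite sequence of deletions of simplicial edges (i.e., repeatedly replacing the current clutter D by D \ e = {F ∈ D : e ⊄ F} for some simplicial edge e of D). Then the circuit ideal I(C̄) ⊆ K[x_1,…,x_n] has a 3-linear resolution over any field K. -/

import Mathlib

open MvPolynomial

noncomputable section

/-- A graded free resolution of the ideal `I` over the polynomial ring `K[xᵢ : i ∈ σ]`:
the `i`-th free module has rank `b i`, its `k`-th standard generator sits in degree
`deg i k`; `aug` is the augmentation map onto `I` and `d i` are the differentials.
All maps are graded (matrix entries are homogeneous of the appropriate degrees) and the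
complex is exact. -/
def IsGradedFreeResolution {sig K : Type*} [Field K]
    (I : Ideal (MvPolynomial sig K)) (b : ℕ → ℕ) (deg : (i : ℕ) → Fin (b i) → ℕ)
    (aug : (Fin (b 0) → MvPolynomial sig K) →ₗ[MvPolynomial sig K] MvPolynomial sig K)
    (d : (i : ℕ) → ((Fin (b (i + 1)) → MvPolynomial sig K) →ₗ[MvPolynomial sig K]
      (Fin (b i) → MvPolynomial sig K))) : Prop :=
  LinearMap.range aug = I ∧
  (∀ k, (aug (Pi.single k 1)).IsHomogeneous (deg 0 k)) ∧
  (∀ i k l, (d i) (Pi.single k 1) l = 0 ∨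
    ∃ e, deg i l + e = deg (i + 1) k ∧ ((d i) (Pi.single k 1) l).IsHomogeneous e) ∧
  LinearMap.ker aug = LinearMap.range (d 0) ∧
  (∀ i, LinearMap.ker (d i) = LinearMap.range (d (i + 1)))

/-- `I` has a `q`-linear resolution: `I` has a graded free resolution in which the `i`-th
free module is generated entirely in degree `q + i`.  (Equivalently, `I` is generated in
degree `q` and `β_{i,j}(I) = 0` whenever `j ≠ i + q`.) -/
def HasLinearResolution {sig K : Type*} [Field K] (q : ℕ)
    (I : Ideal (MvPolynomial sig K)) : Prop :=
  ∃ b deg aug d, IsGradedFreeResolution I b deg aug d ∧ ∀ i k, deg i k = q + i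

/-- The Castelnuovo–Mumford regularity of `I`: the least `r` admitting a graded free
resolution of `I` whose `i`-th free module is generated in degrees `≤ r + i`.
(Equivalently, `reg I = sup { j - i : β_{i,j}(I) ≠ 0 }`.) -/
noncomputable def idealReg {sig K : Type*} [Field K] (I : Ideal (MvPolynomial sig K)) : ℕ :=
  sInf {r : ℕ | ∃ b deg aug d, IsGradedFreeResolution I b deg aug d ∧ ∀ i k, deg i k ≤ r + i}

/-- The circuit ideal of a clutter `C` on `[n]`: the ideal generated by the square-free
monomials `x_F = ∏_{i ∈ F} x_i` for the circuits `F ∈ C`. -/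
noncomputable def circuitIdeal {n : ℕ} (K : Type*) [Field K]
    (C : Finset (Finset (Fin n))) : Ideal (MvPolynomial (Fin n) K) :=
  Ideal.span ((fun F => ∏ i ∈ F, (MvPolynomial.X i : MvPolynomial (Fin n) K)) '' ↑C)

/-- The complement of a `d`-uniform clutter `C` on `[n]` inside the maximal `d`-uniform
clutter `C_{n,d}` of all `d`-subsets of `[n]`. -/
def clutterCompl {n : ℕ} (d : ℕ) (C : Finset (Finset (Fin n))) : Finset (Finset (Fin n)) :=
  Finset.powersetCard d (Finset.univ : Finset (Fin n)) \ C

/-- A 2-subset `e` is a simplicial edge of the 3-uniform clutter `C`: `e` is contained in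
some circuit and the closed neighbourhood `N[e] = e ∪ {c : e ∪ {c} ∈ C}` is a clique. -/
def IsSimplicialEdge {n : ℕ} (C : Finset (Finset (Fin n))) (e : Finset (Fin n)) : Prop :=
  e.card = 2 ∧ (∃ F ∈ C, e ⊆ F) ∧
  ∀ F : Finset (Fin n),
    F ⊆ e ∪ Finset.univ.filter (fun c => insert c e ∈ C) → F.card = 3 → F ∈ C

/-- `C` can be transformed to the empty clutter by a finite sequence of deletions of
simplicial edges (`D ↦ D \ e = {F ∈ D : e ⊄ F}`). -/
inductive ReducibleToEmpty {n : ℕ} : Finset (Finset (Fin n)) → Prop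
  | empty : ReducibleToEmpty ∅
  | step (C : Finset (Finset (Fin n))) (e : Finset (Fin n)) (he : IsSimplicialEdge C e)
      (h : ReducibleToEmpty (C.filter (fun F => ¬ e ⊆ F))) : ReducibleToEmpty C

universe u

theorem MvPolynomial.homogeneousComponent_add_mul {σ R : Type*} [CommSemiring R] {j d : ℕ}
    (f : MvPolynomial σ R) {g : MvPolynomial σ R} (hg : g.IsHomogeneous d) :
    homogeneousComponent (j + d) (f * g) = homogeneousComponent j f * g := by
  conv_lhs => rw [← sum_homogeneousComponent f, Finset.sum_mul, map_sum]
  have key : ∀ i, homogeneousComponent (j + d) (homogeneousComponent i f * g) =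
      if j = i then homogeneousComponent j f * g else 0 := by
    intro i
    rw [homogeneousComponent_of_mem (((homogeneousComponent_isHomogeneous i f).mul hg))]
    by_cases h : j = i
    · subst h; simp
    · rw [if_neg h, if_neg (by omega)]
  simp_rw [key]
  rw [Finset.sum_ite_eq]
  split_ifs with h
  · rfl
  · rw [homogeneousComponent_eq_zero _ _ (by simpa [Nat.lt_succ_iff] using h), zero_mul]

/-- A module over `K[xᵢ : i ∈ σ]` together with `K`-linear endomorphisms `proj j`, to be thought of
as the projections onto the graded pieces; only the compatibilities with the piece of degree `0`
that are needed to speak about resolutions are recorded. -/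
structure GradedMod (σ : Type) (K : Type u) [Field K] where
  /-- the underlying module -/
  carrier : Type u
  [addCommGroup : AddCommGroup carrier]
  [moduleK : Module K carrier]
  [moduleS : Module (MvPolynomial σ K) carrier]
  [isScalarTower : IsScalarTower K (MvPolynomial σ K) carrier]
  /-- the projection onto the graded piece of the given degree -/
  proj : ℕ → carrier →ₗ[K] carrier
  proj_zero_proj_zero : ∀ m, proj 0 (proj 0 m) = proj 0 m
  proj_smul : ∀ j (s : MvPolynomial σ K) m,
    proj j (s • proj 0 m) = homogeneousComponent j s • proj 0 m

namespace GradedMod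

attribute [instance] addCommGroup moduleK moduleS isScalarTower

variable {σ : Type} {K : Type u} [Field K]

instance : CoeSort (GradedMod σ K) (Type u) := ⟨carrier⟩

/-- The graded piece of degree `0`. -/
def piece (M : GradedMod σ K) : Submodule K M := LinearMap.range (M.proj 0)

theorem proj_zero_of_mem (M : GradedMod σ K) {m : M} (hm : m ∈ M.piece) : M.proj 0 m = m := by
  obtain ⟨m, rfl⟩ := hm
  exact M.proj_zero_proj_zero m

theorem proj_smul_of_mem (M : GradedMod σ K) (j : ℕ) (s : MvPolynomial σ K) {m : M}
    (hm : m ∈ M.piece) : M.proj j (s • m) = homogeneousComponent j s • m := by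
  obtain ⟨m, rfl⟩ := hm
  exact M.proj_smul j s m

open TensorProduct

/-- The free module on the degree `0` piece. -/
abbrev Free (M : GradedMod σ K) : Type u := MvPolynomial σ K ⊗[K] M.piece

/-- The canonical map from the free module on the degree `0` piece. -/
def cover (M : GradedMod σ K) : M.Free →ₗ[MvPolynomial σ K] M :=
  LinearMap.liftBaseChange (MvPolynomial σ K) M.piece.subtype

@[simp]
theorem cover_tmul (M : GradedMod σ K) (s : MvPolynomial σ K) (v : M.piece) :
    M.cover (s ⊗ₜ v) = s • (v : M) := by
  simp [cover]

/-- The projection of the free cover onto its component of the given degree. -/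
def freeProj (M : GradedMod σ K) (j : ℕ) : M.Free →ₗ[K] M.Free :=
  LinearMap.rTensor M.piece (homogeneousComponent j)

@[simp]
theorem freeProj_tmul (M : GradedMod σ K) (j : ℕ) (s : MvPolynomial σ K) (v : M.piece) :
    M.freeProj j (s ⊗ₜ v) = homogeneousComponent j s ⊗ₜ v := by
  simp [freeProj]

theorem cover_freeProj (M : GradedMod σ K) (j : ℕ) (x : M.Free) :
    M.cover (M.freeProj j x) = M.proj j (M.cover x) := by
  induction x using TensorProduct.induction_on with
  | zero => simp
  | add x y hx hy => simp only [map_add, hx, hy]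
  | tmul s v => simp [M.proj_smul_of_mem j s v.2]

theorem freeProj_freeProj (M : GradedMod σ K) (j : ℕ) (x : M.Free) :
    M.freeProj j (M.freeProj j x) = M.freeProj j x := by
  induction x using TensorProduct.induction_on with
  | zero => simp
  | add x y hx hy => simp only [map_add, hx, hy]
  | tmul s v =>
    simp [homogeneousComponent_eq_self (homogeneousComponent_isHomogeneous j s)]

theorem freeProj_smul (M : GradedMod σ K) (j d : ℕ) (s : MvPolynomial σ K) (x : M.Free) :
    M.freeProj (j + d) (s • M.freeProj d x) = homogeneousComponent j s • M.freeProj d x := by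
  induction x using TensorProduct.induction_on with
  | zero => simp
  | add x y hx hy => simp only [map_add, smul_add, hx, hy]
  | tmul t v =>
    simp [smul_tmul', homogeneousComponent_add_mul _ (homogeneousComponent_isHomogeneous d t)]

/-- The first syzygy module: the kernel of the canonical map from the free module on the degree `0`
piece, regraded so that its component of degree `1` becomes the piece of degree `0`. -/
def syz (M : GradedMod σ K) : GradedMod σ K where
  carrier := LinearMap.ker M.cover
  proj j := (M.freeProj (j + 1)).restrict (p := (LinearMap.ker M.cover).restrictScalars K)
    (q := (LinearMap.ker M.cover).restrictScalars K) fun x hx => by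
      simp only [Submodule.restrictScalars_mem, LinearMap.mem_ker] at hx ⊢
      rw [cover_freeProj, hx, map_zero]
  proj_zero_proj_zero m := Subtype.ext (M.freeProj_freeProj 1 m.1)
  proj_smul j s m := Subtype.ext (M.freeProj_smul j 1 s m.1)

/-- The inclusion of the first syzygy module into the free cover. -/
def syzIncl (M : GradedMod σ K) : M.syz →ₗ[MvPolynomial σ K] M.Free :=
  (LinearMap.ker M.cover).subtype

theorem syzIncl_injective (M : GradedMod σ K) : Function.Injective M.syzIncl :=
  Subtype.val_injective

theorem syzIncl_proj (M : GradedMod σ K) (j : ℕ) (x : M.syz) :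
    M.syzIncl (M.syz.proj j x) = M.freeProj (j + 1) (M.syzIncl x) := rfl

theorem range_syzIncl (M : GradedMod σ K) : LinearMap.range M.syzIncl = LinearMap.ker M.cover :=
  Submodule.range_subtype _

/-- The module is generated by its finite-dimensional degree `0` piece, and the same holds for
its first `k - 1` iterated syzygy modules. -/
def LinearUpTo : ℕ → GradedMod σ K → Prop
  | 0, _ => True
  | k + 1, M => Function.Surjective M.cover ∧ Module.Finite K M.piece ∧ LinearUpTo k M.syz

/-- The module has a linear resolution, with generators in degree `0`. -/
def Linear (M : GradedMod σ K) : Prop := ∀ k, LinearUpTo k M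

theorem Linear.syz {M : GradedMod σ K} (h : M.Linear) : M.syz.Linear := fun k => (h (k + 1)).2.2

theorem Linear.cover_surjective {M : GradedMod σ K} (h : M.Linear) :
    Function.Surjective M.cover := (h 1).1

theorem Linear.finite_piece {M : GradedMod σ K} (h : M.Linear) : Module.Finite K M.piece :=
  (h 1).2.1

/-- A linear map is graded if it commutes with the projections. -/
def IsGraded {A B : GradedMod σ K} (f : A →ₗ[MvPolynomial σ K] B) : Prop :=
  ∀ j a, f (A.proj j a) = B.proj j (f a)

section Functoriality

variable {A B C : GradedMod σ K} {f : A →ₗ[MvPolynomial σ K] B} {g : B →ₗ[MvPolynomial σ K] C}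

/-- The map between degree `0` pieces induced by a graded map. -/
def mapPiece (f : A →ₗ[MvPolynomial σ K] B) (hf : IsGraded f) : A.piece →ₗ[K] B.piece :=
  (f.restrictScalars K).restrict fun a ha => ⟨f a, by
    rw [← hf, A.proj_zero_of_mem ha, LinearMap.restrictScalars_apply]⟩

@[simp]
theorem coe_mapPiece (hf : IsGraded f) (v : A.piece) : (mapPiece f hf v : B) = f v := rfl

/-- The map between free covers induced by a graded map. -/
def mapFree (f : A →ₗ[MvPolynomial σ K] B) (hf : IsGraded f) :
    A.Free →ₗ[MvPolynomial σ K] B.Free :=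
  (mapPiece f hf).baseChange (MvPolynomial σ K)

@[simp]
theorem mapFree_tmul (hf : IsGraded f) (s : MvPolynomial σ K) (v : A.piece) :
    mapFree f hf (s ⊗ₜ v) = s ⊗ₜ mapPiece f hf v := rfl

theorem cover_mapFree (hf : IsGraded f) (x : A.Free) :
    B.cover (mapFree f hf x) = f (A.cover x) := by
  induction x using TensorProduct.induction_on with
  | zero => simp
  | add x y hx hy => simp only [map_add, hx, hy]
  | tmul s v => simp

theorem mapFree_freeProj (hf : IsGraded f) (j : ℕ) (x : A.Free) :
    mapFree f hf (A.freeProj j x) = B.freeProj j (mapFree f hf x) := by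
  induction x using TensorProduct.induction_on with
  | zero => simp
  | add x y hx hy => simp only [map_add, hx, hy]
  | tmul s v => simp

/-- The map between first syzygy modules induced by a graded map. -/
def mapSyz (f : A →ₗ[MvPolynomial σ K] B) (hf : IsGraded f) :
    A.syz →ₗ[MvPolynomial σ K] B.syz :=
  (mapFree f hf).restrict (p := LinearMap.ker A.cover) (q := LinearMap.ker B.cover) fun x hx => by
    rw [LinearMap.mem_ker] at hx ⊢
    rw [cover_mapFree, hx, map_zero]

theorem isGraded_mapSyz (hf : IsGraded f) : IsGraded (mapSyz f hf) := fun j x =>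
  Subtype.ext (mapFree_freeProj hf (j + 1) x.1)

/-- A short exact sequence of graded maps. -/
structure IsShortExact (f : A →ₗ[MvPolynomial σ K] B) (g : B →ₗ[MvPolynomial σ K] C) : Prop where
  isGraded_left : IsGraded f
  isGraded_right : IsGraded g
  injective : Function.Injective f
  surjective : Function.Surjective g
  exact : Function.Exact f g

namespace IsShortExact

theorem mapPiece_injective (h : IsShortExact f g) :
    Function.Injective (mapPiece f h.isGraded_left) := fun _ _ hvw =>
  Subtype.ext (h.injective (congrArg Subtype.val hvw))

theorem mapPiece_surjective (h : IsShortExact f g) :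
    Function.Surjective (mapPiece g h.isGraded_right) := by
  rintro ⟨c, hc⟩
  obtain ⟨b, rfl⟩ := h.surjective c
  refine ⟨⟨B.proj 0 b, b, rfl⟩, Subtype.ext ?_⟩
  rw [coe_mapPiece, h.isGraded_right, C.proj_zero_of_mem hc]

theorem mapPiece_exact (h : IsShortExact f g) :
    Function.Exact (mapPiece f h.isGraded_left) (mapPiece g h.isGraded_right) := by
  rintro ⟨b, hb⟩
  constructor
  · intro hgb
    obtain ⟨a, rfl⟩ := (h.exact b).1 (congrArg Subtype.val hgb)
    refine ⟨⟨A.proj 0 a, a, rfl⟩, Subtype.ext ?_⟩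
    rw [coe_mapPiece, h.isGraded_left, B.proj_zero_of_mem hb]
  · rintro ⟨a, ha⟩
    rw [← ha]
    exact Subtype.ext (h.exact.apply_apply_eq_zero _)

theorem mapFree_injective (h : IsShortExact f g) :
    Function.Injective (mapFree f h.isGraded_left) := by
  rw [mapFree, LinearMap.baseChange_eq_ltensor]
  exact Module.Flat.lTensor_preserves_injective_linearMap _ h.mapPiece_injective

theorem mapFree_surjective (h : IsShortExact f g) :
    Function.Surjective (mapFree g h.isGraded_right) := by
  rw [mapFree, LinearMap.baseChange_eq_ltensor]
  exact LinearMap.lTensor_surjective _ h.mapPiece_surjective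

theorem mapFree_exact (h : IsShortExact f g) :
    Function.Exact (mapFree f h.isGraded_left) (mapFree g h.isGraded_right) := by
  rw [mapFree, mapFree, LinearMap.baseChange_eq_ltensor, LinearMap.baseChange_eq_ltensor]
  exact lTensor_exact _ h.mapPiece_exact h.mapPiece_surjective

/-- The snake lemma: taking first syzygy modules is exact. -/
theorem syz (h : IsShortExact f g) (hA : Function.Surjective A.cover) :
    IsShortExact (mapSyz f h.isGraded_left) (mapSyz g h.isGraded_right) where
  isGraded_left := isGraded_mapSyz _
  isGraded_right := isGraded_mapSyz _
  injective x y hxy := Subtype.ext (h.mapFree_injective (congrArg Subtype.val hxy))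
  surjective := by
    rintro ⟨c, hc⟩
    obtain ⟨b, rfl⟩ := h.mapFree_surjective c
    rw [LinearMap.mem_ker, cover_mapFree] at hc
    obtain ⟨a, ha⟩ := (h.exact _).1 hc
    obtain ⟨x, rfl⟩ := hA a
    refine ⟨⟨b - mapFree f h.isGraded_left x, ?_⟩, Subtype.ext ?_⟩
    · rw [LinearMap.mem_ker, map_sub, cover_mapFree, ha, sub_self]
    · change mapFree g h.isGraded_right (b - mapFree f h.isGraded_left x) = _
      rw [map_sub, h.mapFree_exact.apply_apply_eq_zero, sub_zero]
  exact := by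
    rintro ⟨b, hb⟩
    constructor
    · intro hgb
      obtain ⟨x, rfl⟩ := (h.mapFree_exact b).1 (congrArg Subtype.val hgb)
      rw [LinearMap.mem_ker, cover_mapFree] at hb
      exact ⟨⟨x, h.injective (hb.trans (map_zero f).symm)⟩, rfl⟩
    · rintro ⟨x, hx⟩
      rw [← hx]
      exact Subtype.ext (h.mapFree_exact.apply_apply_eq_zero x.1)

theorem cover_surjective_right (h : IsShortExact f g) (hB : Function.Surjective B.cover) :
    Function.Surjective C.cover := by
  intro c
  obtain ⟨b, rfl⟩ := h.surjective c
  obtain ⟨x, rfl⟩ := hB b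
  exact ⟨_, cover_mapFree h.isGraded_right x⟩

theorem cover_surjective_middle (h : IsShortExact f g) (hA : Function.Surjective A.cover)
    (hC : Function.Surjective C.cover) : Function.Surjective B.cover := by
  intro b
  obtain ⟨y, hy⟩ := hC (g b)
  obtain ⟨x, rfl⟩ := h.mapFree_surjective y
  rw [cover_mapFree] at hy
  obtain ⟨a, ha⟩ := (h.exact (b - B.cover x)).1 (by rw [map_sub, hy, sub_self])
  obtain ⟨z, rfl⟩ := hA a
  refine ⟨mapFree f h.isGraded_left z + x, ?_⟩
  rw [map_add, cover_mapFree, ha, sub_add_cancel]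

end IsShortExact

theorem LinearUpTo.right {k : ℕ} : ∀ {A B C : GradedMod σ K} {f : A →ₗ[MvPolynomial σ K] B}
    {g : B →ₗ[MvPolynomial σ K] C}, IsShortExact f g → LinearUpTo k A → LinearUpTo k B →
    LinearUpTo k C := by
  induction k with
  | zero => exact fun _ _ _ => trivial
  | succ k ih =>
    intro A B C f g h hA hB
    have := hB.2.1
    exact ⟨h.cover_surjective_right hB.1, Module.Finite.of_surjective _ h.mapPiece_surjective,
      ih (h.syz hA.1) hA.2.2 hB.2.2⟩

theorem LinearUpTo.middle {k : ℕ} : ∀ {A B C : GradedMod σ K} {f : A →ₗ[MvPolynomial σ K] B}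
    {g : B →ₗ[MvPolynomial σ K] C}, IsShortExact f g → LinearUpTo k A → LinearUpTo k C →
    LinearUpTo k B := by
  induction k with
  | zero => exact fun _ _ _ => trivial
  | succ k ih =>
    intro A B C f g h hA hC
    have := hA.2.1
    have := hC.2.1
    exact ⟨h.cover_surjective_middle hA.1 hC.1,
      Module.Finite.of_exact h.mapPiece_exact h.mapPiece_surjective,
      ih (h.syz hA.1) hA.2.2 hC.2.2⟩

theorem Linear.right (h : IsShortExact f g) (hA : A.Linear) (hB : B.Linear) : C.Linear :=
  fun k => (hA k).right h (hB k)

theorem Linear.middle (h : IsShortExact f g) (hA : A.Linear) (hC : C.Linear) : B.Linear :=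
  fun k => (hA k).middle h (hC k)

theorem linear_of_subsingleton (M : GradedMod σ K) [Subsingleton M] : M.Linear := by
  intro k
  induction k generalizing M with
  | zero => trivial
  | succ k ih =>
    have hM : Subsingleton M.Free := by
      refine subsingleton_of_forall_eq 0 fun x => ?_
      induction x using TensorProduct.induction_on with
      | zero => rfl
      | add x y hx hy => rw [hx, hy, add_zero]
      | tmul s v => rw [Subsingleton.elim v 0, tmul_zero]
    have : Subsingleton M.syz := inferInstanceAs (Subsingleton (LinearMap.ker M.cover))
    exact ⟨fun m => ⟨0, Subsingleton.elim _ _⟩, inferInstance, ih _⟩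

/-- The zero module. -/
def zero (σ : Type) (K : Type u) [Field K] : GradedMod σ K where
  carrier := PUnit
  proj _ := 0
  proj_zero_proj_zero _ := rfl
  proj_smul _ _ _ := rfl

theorem Linear.of_bijective (hf : IsGraded f) (hbij : Function.Bijective f) (hA : A.Linear) :
    B.Linear := by
  have : Subsingleton (zero σ K) := inferInstanceAs (Subsingleton PUnit)
  refine Linear.middle (A := A) (B := B) (C := zero σ K) (f := f) (g := 0)
    ⟨hf, fun _ _ => rfl, hbij.1, fun _ => ⟨0, Subsingleton.elim _ _⟩,
      fun b => ⟨fun _ => hbij.2 b, fun _ => rfl⟩⟩ hA (linear_of_subsingleton _)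

end Functoriality

/-- The cokernel of a graded map. -/
def coker {A B : GradedMod σ K} (f : A →ₗ[MvPolynomial σ K] B) (hf : IsGraded f) :
    GradedMod σ K where
  carrier := B ⧸ LinearMap.range f
  proj j :=
    (Submodule.Quotient.restrictScalarsEquiv K (LinearMap.range f)).toLinearMap ∘ₗ
      Submodule.mapQ ((LinearMap.range f).restrictScalars K)
        ((LinearMap.range f).restrictScalars K) (B.proj j) (by
          rintro _ ⟨a, rfl⟩
          exact ⟨A.proj j a, hf j a⟩) ∘ₗ
      (Submodule.Quotient.restrictScalarsEquiv K (LinearMap.range f)).symm.toLinearMap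
  proj_zero_proj_zero m := by
    obtain ⟨b, rfl⟩ := Submodule.Quotient.mk_surjective _ m
    exact congrArg Submodule.Quotient.mk (B.proj_zero_proj_zero b)
  proj_smul j s m := by
    obtain ⟨b, rfl⟩ := Submodule.Quotient.mk_surjective _ m
    exact congrArg Submodule.Quotient.mk (B.proj_smul j s b)

/-- The projection onto the cokernel. -/
def cokerMk {A B : GradedMod σ K} (f : A →ₗ[MvPolynomial σ K] B) (hf : IsGraded f) :
    B →ₗ[MvPolynomial σ K] coker f hf :=
  (LinearMap.range f).mkQ

theorem isGraded_cokerMk {A B : GradedMod σ K} (f : A →ₗ[MvPolynomial σ K] B) (hf : IsGraded f) :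
    IsGraded (cokerMk f hf) := fun _ _ => rfl

theorem cokerMk_surjective {A B : GradedMod σ K} (f : A →ₗ[MvPolynomial σ K] B)
    (hf : IsGraded f) : Function.Surjective (cokerMk f hf) :=
  Submodule.mkQ_surjective _

theorem cokerMk_eq_zero {A B : GradedMod σ K} {f : A →ₗ[MvPolynomial σ K] B} {hf : IsGraded f}
    {b : B} : cokerMk f hf b = 0 ↔ b ∈ LinearMap.range f :=
  Submodule.Quotient.mk_eq_zero _

theorem isShortExact_coker {A B : GradedMod σ K} (f : A →ₗ[MvPolynomial σ K] B) (hf : IsGraded f)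
    (hinj : Function.Injective f) : IsShortExact f (cokerMk f hf) :=
  ⟨hf, isGraded_cokerMk f hf, hinj, cokerMk_surjective f hf, fun _ => cokerMk_eq_zero⟩

/-- A module generated by one element of degree `0` is linear as soon as the annihilator of this
element, with its elements of degree `1` put in degree `0`, is linear. -/
theorem linear_of_cyclic {M Q : GradedMod σ K} {m : M} (hm : m ∈ M.piece)
    (hgen : ∀ x : M, ∃ s : MvPolynomial σ K, s • m = x)
    (φ : Q →ₗ[MvPolynomial σ K] MvPolynomial σ K) (hφ : Function.Injective φ)
    (hφ' : ∀ j q, φ (Q.proj j q) = homogeneousComponent (j + 1) (φ q))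
    (hann : ∀ s : MvPolynomial σ K, s • m = 0 ↔ s ∈ LinearMap.range φ) (hQ : Q.Linear) :
    M.Linear := by
  by_cases hm0 : m = 0
  · have : Subsingleton M := subsingleton_of_forall_eq 0 fun x => by
      obtain ⟨s, rfl⟩ := hgen x
      rw [hm0, smul_zero]
    exact linear_of_subsingleton M
  have hpiece : ∀ v : M.piece, ∃ c : K, c • (⟨m, hm⟩ : M.piece) = v := by
    rintro ⟨v, hv⟩
    obtain ⟨s, rfl⟩ := hgen v
    refine ⟨coeff 0 s, Subtype.ext ?_⟩
    have h := M.proj_zero_of_mem hv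
    rw [M.proj_smul_of_mem 0 s hm, homogeneousComponent_zero] at h
    rw [← algebraMap_eq, algebraMap_smul] at h
    exact h
  have hfree : ∀ x : M.Free, ∃ s : MvPolynomial σ K, s ⊗ₜ (⟨m, hm⟩ : M.piece) = x := by
    intro x
    induction x using TensorProduct.induction_on with
    | zero => exact ⟨0, zero_tmul _ _⟩
    | add x y hx hy =>
      obtain ⟨s, rfl⟩ := hx
      obtain ⟨t, rfl⟩ := hy
      exact ⟨s + t, add_tmul _ _ _⟩
    | tmul s v =>
      obtain ⟨c, rfl⟩ := hpiece v
      exact ⟨c • s, smul_tmul _ _ _⟩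
  have hinj : Function.Injective
      fun s : MvPolynomial σ K => (s ⊗ₜ (⟨m, hm⟩ : M.piece) : M.Free) := by
    have h1 : Function.Injective (LinearMap.toSpanSingleton K M.piece ⟨m, hm⟩) := by
      rw [← LinearMap.ker_eq_bot]
      refine LinearMap.ker_toSpanSingleton K fun h => hm0 (congrArg Subtype.val h)
    have h2 := (Module.Flat.lTensor_preserves_injective_linearMap (M := MvPolynomial σ K) _ h1).comp
      (TensorProduct.rid K (MvPolynomial σ K)).symm.injective
    convert h2 using 2 with s
    simp
  have hsmul : ∀ s : MvPolynomial σ K, s • ((1 : MvPolynomial σ K) ⊗ₜ[K] (⟨m, hm⟩ : M.piece)) =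
      s ⊗ₜ (⟨m, hm⟩ : M.piece) := fun s => by rw [smul_tmul', smul_eq_mul, mul_one]
  let ψ : Q →ₗ[MvPolynomial σ K] M.syz :=
    (LinearMap.toSpanSingleton (MvPolynomial σ K) M.Free (1 ⊗ₜ ⟨m, hm⟩) ∘ₗ φ).codRestrict
      (LinearMap.ker M.cover) fun q => by
        rw [LinearMap.mem_ker, LinearMap.comp_apply, LinearMap.toSpanSingleton_apply, hsmul,
          cover_tmul]
        exact (hann _).2 ⟨q, rfl⟩
  have hψ : ∀ q, M.syzIncl (ψ q) = φ q ⊗ₜ (⟨m, hm⟩ : M.piece) := fun q => hsmul _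
  have hsyz : M.syz.Linear := by
    refine Linear.of_bijective (f := ψ) (fun j q => M.syzIncl_injective ?_)
      ⟨fun q r hqr => hφ (hinj ?_), fun x => ?_⟩ hQ
    · rw [hψ, syzIncl_proj, hψ, hφ', freeProj_tmul]
    · simpa only [hψ] using congrArg M.syzIncl hqr
    · obtain ⟨s, hs⟩ := hfree (M.syzIncl x)
      have hx : M.cover (M.syzIncl x) = 0 := by
        rw [← LinearMap.mem_ker, ← range_syzIncl]
        exact ⟨x, rfl⟩
      rw [← hs, cover_tmul] at hx
      obtain ⟨q, rfl⟩ := (hann s).1 hx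
      exact ⟨q, M.syzIncl_injective ((hψ q).trans hs)⟩
  intro k
  cases k with
  | zero => trivial
  | succ k =>
    refine ⟨fun x => ?_, Module.Finite.of_surjective
      (LinearMap.toSpanSingleton K M.piece ⟨m, hm⟩) hpiece, hsyz k⟩
    obtain ⟨s, rfl⟩ := hgen x
    exact ⟨s ⊗ₜ ⟨m, hm⟩, cover_tmul _ _ _⟩

/-- An ideal stable under taking homogeneous components, with its elements of degree `d`
put in degree `0`. -/
def ofIdeal (I : Ideal (MvPolynomial σ K)) (hI : ∀ j, ∀ f ∈ I, homogeneousComponent j f ∈ I)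
    (d : ℕ) : GradedMod σ K where
  carrier := I
  isScalarTower := ⟨fun a s f => Subtype.ext (smul_assoc a s f.1)⟩
  proj j := (homogeneousComponent (j + d)).restrict (p := I.restrictScalars K)
    (q := I.restrictScalars K) (hI (j + d))
  proj_zero_proj_zero f := Subtype.ext <|
    homogeneousComponent_eq_self (homogeneousComponent_isHomogeneous _ _)
  proj_smul j s f := Subtype.ext <| homogeneousComponent_add_mul _ <| by
    have h := homogeneousComponent_isHomogeneous (0 + d) f.1
    rwa [zero_add] at h ⊢

/-- The inclusion of an ideal into the polynomial ring. -/
def idealIncl (I : Ideal (MvPolynomial σ K)) (hI : ∀ j, ∀ f ∈ I, homogeneousComponent j f ∈ I)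
    (d : ℕ) : ofIdeal I hI d →ₗ[MvPolynomial σ K] MvPolynomial σ K :=
  I.subtype

theorem idealIncl_injective (I : Ideal (MvPolynomial σ K))
    (hI : ∀ j, ∀ f ∈ I, homogeneousComponent j f ∈ I) (d : ℕ) :
    Function.Injective (idealIncl I hI d) :=
  Subtype.val_injective

theorem range_idealIncl (I : Ideal (MvPolynomial σ K))
    (hI : ∀ j, ∀ f ∈ I, homogeneousComponent j f ∈ I) (d : ℕ) :
    LinearMap.range (idealIncl I hI d) = I :=
  Submodule.range_subtype I

theorem idealIncl_proj {I : Ideal (MvPolynomial σ K)}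
    {hI : ∀ j, ∀ f ∈ I, homogeneousComponent j f ∈ I} {d : ℕ} (j : ℕ) (f : ofIdeal I hI d) :
    idealIncl I hI d ((ofIdeal I hI d).proj j f) =
      homogeneousComponent (j + d) (idealIncl I hI d f) := rfl

section Resolution

variable {M : GradedMod σ K}

/-- The iterated syzygy modules. -/
def iterSyz (M : GradedMod σ K) : ℕ → GradedMod σ K
  | 0 => M
  | i + 1 => (iterSyz M i).syz

theorem Linear.iterSyz (hM : M.Linear) (i : ℕ) : (M.iterSyz i).Linear := by
  induction i with
  | zero => exact hM
  | succ i ih => exact ih.syz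

variable (M)

/-- The coordinates of the free cover with respect to a basis of the degree `0` piece. -/
def coords [Module.Finite K M.piece] :
    M.Free ≃ₗ[MvPolynomial σ K] (Fin (Module.finrank K M.piece) → MvPolynomial σ K) :=
  (Algebra.TensorProduct.basis (MvPolynomial σ K) (Module.finBasis K M.piece)).equivFun

theorem coords_freeProj [Module.Finite K M.piece] (j : ℕ) (x : M.Free)
    (l : Fin (Module.finrank K M.piece)) :
    M.coords (M.freeProj j x) l = homogeneousComponent j (M.coords x l) := by
  induction x using TensorProduct.induction_on with
  | zero => simp
  | add x y hx hy => simp only [map_add, Pi.add_apply, hx, hy]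
  | tmul s v => simp [coords, mul_comm _ (C _)]

theorem coords_symm_single [Module.Finite K M.piece] (k : Fin (Module.finrank K M.piece)) :
    M.coords.symm (Pi.single k 1) = 1 ⊗ₜ Module.finBasis K M.piece k := by
  rw [coords, Module.Basis.equivFun_symm_apply]
  simp [Pi.single_apply]

theorem Linear.hasLinearResolution {I : Ideal (MvPolynomial σ K)}
    {hI : ∀ j, ∀ f ∈ I, homogeneousComponent j f ∈ I} {q : ℕ} (h : (ofIdeal I hI q).Linear) :
    HasLinearResolution q I := by
  let N : ℕ → GradedMod σ K := (ofIdeal I hI q).iterSyz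
  have hN : ∀ i, (N i).Linear := h.iterSyz
  have hfin : ∀ i, Module.Finite K (N i).piece := fun i => (hN i).finite_piece
  let c : ∀ i, (Fin (Module.finrank K (N i).piece) → MvPolynomial σ K) →ₗ[MvPolynomial σ K] N i :=
    fun i => (N i).cover ∘ₗ (N i).coords.symm.toLinearMap
  have hc : ∀ i, Function.Surjective (c i) := fun i =>
    (hN i).cover_surjective.comp (N i).coords.symm.surjective
  have hc_single : ∀ i k, c i (Pi.single k 1) = Module.finBasis K (N i).piece k := fun i k => by
    simp only [c, LinearMap.comp_apply, LinearEquiv.coe_coe, coords_symm_single, cover_tmul,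
      one_smul]
  let inc : ∀ i, N (i + 1) →ₗ[MvPolynomial σ K] (N i).Free := fun i => (N i).syzIncl
  have hinc : ∀ i, LinearMap.range (inc i) = LinearMap.ker (N i).cover :=
    fun i => (N i).range_syzIncl
  let ι : ∀ i, N (i + 1) →ₗ[MvPolynomial σ K]
      (Fin (Module.finrank K (N i).piece) → MvPolynomial σ K) :=
    fun i => (N i).coords.toLinearMap ∘ₗ inc i
  have hι : ∀ i, Function.Injective (ι i) := fun i =>
    (N i).coords.injective.comp (N i).syzIncl_injective
  have hιc : ∀ i, LinearMap.range (ι i) = LinearMap.ker (c i) := fun i => by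
    simp only [ι, c]
    rw [LinearMap.range_comp, hinc, LinearMap.ker_comp]
    exact Submodule.map_equiv_eq_comap_symm _ _
  have hrange : ∀ i, LinearMap.range (ι i ∘ₗ c (i + 1)) = LinearMap.ker (c i) := fun i => by
    rw [LinearMap.range_comp_of_range_eq_top _ (LinearMap.range_eq_top.2 (hc _)), hιc]
  have hιker : ∀ i, LinearMap.ker (ι i) = ⊥ := fun i => LinearMap.ker_eq_bot.2 (hι i)
  let a : N 0 →ₗ[MvPolynomial σ K] MvPolynomial σ K := idealIncl I hI q
  have ha : LinearMap.ker a = ⊥ := LinearMap.ker_eq_bot.2 (idealIncl_injective I hI q)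
  have ha' : LinearMap.range a = I := range_idealIncl I hI q
  refine ⟨fun i => Module.finrank K (N i).piece, fun i _ => q + i, a ∘ₗ c 0,
    fun i => ι i ∘ₗ c (i + 1), ⟨?_, ?_, ?_, ?_, ?_⟩, fun _ _ => rfl⟩
  · rw [LinearMap.range_comp_of_range_eq_top _ (LinearMap.range_eq_top.2 (hc 0)), ha']
  · intro k
    rw [LinearMap.comp_apply, hc_single]
    have hk := (N 0).proj_zero_of_mem (Module.finBasis K (N 0).piece k).2
    have hk' : a _ = homogeneousComponent (0 + q) _ :=
      (congrArg a hk).symm.trans (idealIncl_proj 0 _)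
    rw [hk', add_comm]
    exact homogeneousComponent_isHomogeneous _ _
  · intro i k l
    refine Or.inr ⟨1, rfl, ?_⟩
    rw [LinearMap.comp_apply, hc_single]
    have hk := (N (i + 1)).proj_zero_of_mem (Module.finBasis K (N (i + 1)).piece k).2
    have hk' : (N i).syzIncl _ = (N i).freeProj (0 + 1) _ :=
      (congrArg (N i).syzIncl hk).symm.trans ((N i).syzIncl_proj 0 _)
    change ((N i).coords ((N i).syzIncl _) l).IsHomogeneous 1
    rw [hk', coords_freeProj]
    exact homogeneousComponent_isHomogeneous _ _
  · rw [hrange, LinearMap.ker_comp_of_ker_eq_bot _ ha]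
  · intro i
    rw [hrange, LinearMap.ker_comp_of_ker_eq_bot _ (hιker i)]

end Resolution

section Ideals

variable {I J L Q : Ideal (MvPolynomial σ K)} {d : ℕ}
  {hI : ∀ j, ∀ f ∈ I, homogeneousComponent j f ∈ I}
  {hJ : ∀ j, ∀ f ∈ J, homogeneousComponent j f ∈ J}
  {hL : ∀ j, ∀ f ∈ L, homogeneousComponent j f ∈ L}
  {hQ : ∀ j, ∀ f ∈ Q, homogeneousComponent j f ∈ Q}

/-- The inclusion between two ideals. -/
def idealMap (hI : ∀ j, ∀ f ∈ I, homogeneousComponent j f ∈ I)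
    (hJ : ∀ j, ∀ f ∈ J, homogeneousComponent j f ∈ J) (d : ℕ) (h : I ≤ J) :
    ofIdeal I hI d →ₗ[MvPolynomial σ K] ofIdeal J hJ d :=
  Submodule.inclusion h

@[simp]
theorem idealIncl_idealMap (h : I ≤ J) (f : ofIdeal I hI d) :
    idealIncl J hJ d (idealMap hI hJ d h f) = idealIncl I hI d f := rfl

theorem isGraded_idealMap (h : I ≤ J) : IsGraded (idealMap hI hJ d h) := fun _ _ => rfl

theorem idealMap_injective (h : I ≤ J) : Function.Injective (idealMap hI hJ d h) :=
  Submodule.inclusion_injective h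

theorem exists_idealIncl_eq {f : MvPolynomial σ K} (hf : f ∈ I) :
    ∃ g : ofIdeal I hI d, idealIncl I hI d g = f :=
  ⟨⟨f, hf⟩, rfl⟩

theorem idealIncl_mem (f : ofIdeal I hI d) : idealIncl I hI d f ∈ I :=
  Subtype.property f

theorem mem_range_idealMap {h : I ≤ J} {f : ofIdeal J hJ d} :
    f ∈ LinearMap.range (idealMap hI hJ d h) ↔ idealIncl J hJ d f ∈ I := by
  constructor
  · rintro ⟨g, rfl⟩
    exact idealIncl_mem g
  · intro hf
    exact ⟨⟨_, hf⟩, rfl⟩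

/-- If `I` is linear and the colon ideal `(I : u)` is linear with generators in degree `1`, then
`I + (u)` is linear. -/
theorem Linear.sup_span_singleton {u : MvPolynomial σ K} (hu : u.IsHomogeneous d)
    (hIJ : I ⊔ Ideal.span {u} = J) (hcolon : ∀ s, s * u ∈ I ↔ s ∈ Q)
    (hIl : (ofIdeal I hI d).Linear) (hQl : (ofIdeal Q hQ 1).Linear) :
    (ofIdeal J hJ d).Linear := by
  have hle : I ≤ J := hIJ ▸ le_sup_left
  have huJ : u ∈ J := hIJ ▸ Ideal.mem_sup_right (Ideal.mem_span_singleton_self u)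
  obtain ⟨u', rfl⟩ : ∃ u' : ofIdeal J hJ d, idealIncl J hJ d u' = u := exists_idealIncl_eq huJ
  refine Linear.middle (isShortExact_coker (idealMap hI hJ d hle) (isGraded_idealMap hle)
    (idealMap_injective hle)) hIl ?_
  refine linear_of_cyclic (m := cokerMk _ _ u') ⟨cokerMk _ _ u', ?_⟩ (fun x => ?_)
    (idealIncl Q hQ 1) (idealIncl_injective Q hQ 1) idealIncl_proj (fun s => ?_) hQl
  · rw [← isGraded_cokerMk]
    congr 1
    refine idealIncl_injective J hJ d ?_
    rw [idealIncl_proj, zero_add, homogeneousComponent_eq_self hu]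
  · obtain ⟨y, rfl⟩ := cokerMk_surjective _ _ x
    have hy := hIJ.ge (idealIncl_mem y)
    obtain ⟨i, hi, w, hw, hiw⟩ := Submodule.mem_sup.1 hy
    obtain ⟨s, rfl⟩ := Ideal.mem_span_singleton'.1 hw
    refine ⟨s, ?_⟩
    rw [← map_smul, ← sub_eq_zero, ← map_sub, cokerMk_eq_zero, mem_range_idealMap, map_sub,
      map_smul, ← hiw, smul_eq_mul, sub_add_cancel_right]
    exact neg_mem hi
  · rw [← map_smul, cokerMk_eq_zero, mem_range_idealMap, range_idealIncl, map_smul, smul_eq_mul,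
      hcolon]

/-- If `L`, `I + L` and `I ∩ L` are linear, then so is `I`. -/
theorem Linear.of_sup_of_inf (hIJ : I ⊔ L = J) (hIQ : I ⊓ L = Q)
    (hLl : (ofIdeal L hL d).Linear) (hJl : (ofIdeal J hJ d).Linear)
    (hQl : (ofIdeal Q hQ d).Linear) : (ofIdeal I hI d).Linear := by
  have hIleJ : I ≤ J := hIJ ▸ le_sup_left
  have hLleJ : L ≤ J := hIJ ▸ le_sup_right
  have hQleI : Q ≤ I := hIQ ▸ inf_le_left
  have hU := Linear.right (isShortExact_coker (idealMap hL hJ d hLleJ) (isGraded_idealMap hLleJ)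
    (idealMap_injective hLleJ)) hLl hJl
  refine Linear.middle (f := idealMap hQ hI d hQleI)
    (g := cokerMk _ (isGraded_idealMap hLleJ) ∘ₗ idealMap hI hJ d hIleJ)
    ⟨isGraded_idealMap hQleI, fun _ _ => rfl, idealMap_injective hQleI, fun x => ?_,
      fun f => ?_⟩ hQl hU
  · obtain ⟨y, rfl⟩ := cokerMk_surjective _ _ x
    have hy := hIJ.ge (idealIncl_mem y)
    obtain ⟨i, hi, l, hl, hil⟩ := Submodule.mem_sup.1 hy
    obtain ⟨i', rfl⟩ : ∃ i' : ofIdeal I hI d, idealIncl I hI d i' = i := exists_idealIncl_eq hi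
    refine ⟨i', ?_⟩
    rw [LinearMap.comp_apply, ← sub_eq_zero, ← map_sub, cokerMk_eq_zero, mem_range_idealMap,
      map_sub, idealIncl_idealMap, ← hil, sub_add_cancel_left]
    exact neg_mem hl
  · rw [LinearMap.comp_apply, cokerMk_eq_zero, mem_range_idealMap, idealIncl_idealMap]
    change _ ↔ f ∈ LinearMap.range (idealMap hQ hI d hQleI)
    rw [mem_range_idealMap, ← hIQ]
    exact ⟨fun h => ⟨idealIncl_mem f, h⟩, fun h => h.2⟩

end Ideals

end GradedMod

section MonomialIdeals

variable {σ : Type} (K : Type u) [Field K]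

/-- The ideal generated by the monomials with exponents in `s`. -/
def monomialIdeal (s : Set (σ →₀ ℕ)) : Ideal (MvPolynomial σ K) :=
  Ideal.span ((fun a => monomial a (1 : K)) '' s)

variable {K}

theorem mem_monomialIdeal {s : Set (σ →₀ ℕ)} {f : MvPolynomial σ K} :
    f ∈ monomialIdeal K s ↔ ∀ m ∈ f.support, ∃ a ∈ s, a ≤ m :=
  mem_ideal_span_monomial_image

theorem homogeneousComponent_mem_monomialIdeal (s : Set (σ →₀ ℕ)) (j : ℕ) :
    ∀ f ∈ monomialIdeal K s, homogeneousComponent j f ∈ monomialIdeal K s := by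
  intro f hf
  rw [mem_monomialIdeal] at hf ⊢
  intro m hm
  rw [support_homogeneousComponent, Finset.mem_filter] at hm
  exact hf m hm.1

theorem monomialIdeal_eq_of_forall {s t : Set (σ →₀ ℕ)}
    (h : ∀ m, (∃ a ∈ s, a ≤ m) ↔ ∃ a ∈ t, a ≤ m) : monomialIdeal K s = monomialIdeal K t := by
  ext f
  simp only [mem_monomialIdeal, h]

theorem monomialIdeal_union (s t : Set (σ →₀ ℕ)) :
    monomialIdeal K (s ∪ t) = monomialIdeal K s ⊔ monomialIdeal K t := by
  rw [monomialIdeal, Set.image_union, Ideal.span_union, monomialIdeal, monomialIdeal]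

variable (K) in
/-- The monomial ideal generated by `s` has a linear resolution with generators in degree `d`. -/
def IsLinearMonomial (d : ℕ) (s : Set (σ →₀ ℕ)) : Prop :=
  (GradedMod.ofIdeal (monomialIdeal K s) (homogeneousComponent_mem_monomialIdeal s) d).Linear

theorem isLinearMonomial_empty (d : ℕ) : IsLinearMonomial K d (∅ : Set (σ →₀ ℕ)) := by
  have : Subsingleton (GradedMod.ofIdeal (monomialIdeal K (∅ : Set (σ →₀ ℕ)))
      (homogeneousComponent_mem_monomialIdeal ∅) d) := by
    change Subsingleton (monomialIdeal K (∅ : Set (σ →₀ ℕ)))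
    rw [monomialIdeal, Set.image_empty, Ideal.span_empty]
    infer_instance
  exact GradedMod.linear_of_subsingleton _

theorem mul_monomial_mem_monomialIdeal {s q : Set (σ →₀ ℕ)} {u : σ →₀ ℕ}
    (h : ∀ m, (∃ a ∈ s, a ≤ m + u) ↔ ∃ a ∈ q, a ≤ m) (f : MvPolynomial σ K) :
    f * monomial u 1 ∈ monomialIdeal K s ↔ f ∈ monomialIdeal K q := by
  simp only [mem_monomialIdeal, mem_support_iff]
  constructor
  · intro hf m hm
    exact (h m).1 (hf (m + u) (by rwa [coeff_mul_monomial, mul_one]))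
  · intro hf m hm
    rw [coeff_mul_monomial'] at hm
    split_ifs at hm with hum
    · rw [mul_one] at hm
      have := (h (m - u)).2 (hf _ hm)
      rwa [tsub_add_cancel_of_le hum] at this
    · exact absurd rfl hm

theorem IsLinearMonomial.insert {d : ℕ} {s q : Set (σ →₀ ℕ)} {u : σ →₀ ℕ} (hu : u.degree = d)
    (h : ∀ m, (∃ a ∈ s, a ≤ m + u) ↔ ∃ a ∈ q, a ≤ m) (hs : IsLinearMonomial K d s)
    (hq : IsLinearMonomial K 1 q) : IsLinearMonomial K d (insert u s) := by
  refine GradedMod.Linear.sup_span_singleton (isHomogeneous_monomial 1 hu) ?_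
    (mul_monomial_mem_monomialIdeal h) hs hq
  rw [Set.insert_eq, Set.union_comm, monomialIdeal_union]
  congr 1
  rw [monomialIdeal, Set.image_singleton]

theorem IsLinearMonomial.of_union_of_inter {d : ℕ} {s t v r : Set (σ →₀ ℕ)}
    (hv : ∀ m, ((∃ a ∈ s, a ≤ m) ∨ ∃ a ∈ t, a ≤ m) ↔ ∃ a ∈ v, a ≤ m)
    (hr : ∀ m, ((∃ a ∈ s, a ≤ m) ∧ ∃ a ∈ t, a ≤ m) ↔ ∃ a ∈ r, a ≤ m)
    (htl : IsLinearMonomial K d t) (hvl : IsLinearMonomial K d v)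
    (hrl : IsLinearMonomial K d r) : IsLinearMonomial K d s := by
  refine GradedMod.Linear.of_sup_of_inf ?_ ?_ htl hvl hrl
  · rw [← monomialIdeal_union]
    refine monomialIdeal_eq_of_forall fun m => ?_
    simp only [← hv, Set.mem_union, or_and_right, exists_or]
  · ext f
    simp only [Submodule.mem_inf, mem_monomialIdeal, ← hr]
    exact ⟨fun h m hm => ⟨h.1 m hm, h.2 m hm⟩, fun h => ⟨fun m hm => (h m hm).1,
      fun m hm => (h m hm).2⟩⟩

/-- Multiples of a monomial by variables generate a linear ideal. -/
theorem isLinearMonomial_variables [DecidableEq σ] (T : Finset σ) :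
    ∀ {d : ℕ} {u : σ →₀ ℕ}, u.degree = d →
      IsLinearMonomial K (d + 1) ((fun t => u + Finsupp.single t 1) '' (T : Set σ)) := by
  induction T using Finset.induction_on with
  | empty =>
    intro d u _
    rw [Finset.coe_empty, Set.image_empty]
    exact isLinearMonomial_empty _
  | insert t T ht ih =>
    intro d u hu
    rw [Finset.coe_insert, Set.image_insert_eq]
    refine IsLinearMonomial.insert (by simp [hu]) (fun m => ?_) (ih hu) (ih (map_zero _))
    simp only [Set.exists_mem_image, Finset.mem_coe, zero_add]
    refine exists_congr fun a => and_congr_right fun ha => ?_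
    have hat : t ≠ a := fun h => ht (h ▸ ha)
    rw [add_left_comm, add_le_add_iff_left, Finsupp.single_le_iff, Finsupp.single_le_iff,
      Finsupp.add_apply, Finsupp.single_eq_of_ne hat.symm, add_zero]

end MonomialIdeals

section SquarefreeExponents

variable {σ : Type}

/-- The exponent of the squarefree monomial supported on `F`. -/
def sqfreeExp (F : Finset σ) : σ →₀ ℕ := ∑ i ∈ F, Finsupp.single i 1

theorem sqfreeExp_apply [DecidableEq σ] (F : Finset σ) (i : σ) :
    sqfreeExp F i = if i ∈ F then 1 else 0 := by
  simp [sqfreeExp, Finsupp.finsetSum_apply, Finsupp.single_apply]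

theorem degree_sqfreeExp (F : Finset σ) : (sqfreeExp F).degree = F.card := by
  simp [sqfreeExp]

theorem sqfreeExp_le_iff {F : Finset σ} {m : σ →₀ ℕ} : sqfreeExp F ≤ m ↔ F ⊆ m.support := by
  classical
  simp only [Finsupp.le_def, sqfreeExp_apply, Finset.subset_iff, Finsupp.mem_support_iff]
  refine forall_congr' fun i => ?_
  split_ifs with h <;> simp [h, Nat.one_le_iff_ne_zero]

theorem support_add_sqfreeExp [DecidableEq σ] (m : σ →₀ ℕ) (F : Finset σ) :
    (m + sqfreeExp F).support = m.support ∪ F := by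
  ext i
  by_cases h : i ∈ F <;> simp [sqfreeExp_apply, h]

theorem sqfreeExp_add_single [DecidableEq σ] {F : Finset σ} {c : σ} (hc : c ∉ F) :
    sqfreeExp F + Finsupp.single c 1 = sqfreeExp (insert c F) := by
  rw [sqfreeExp, sqfreeExp, Finset.sum_insert hc, add_comm]

end SquarefreeExponents

section Clutters

variable {n : ℕ} {K : Type u} [Field K]

theorem circuitIdeal_eq_monomialIdeal (C : Finset (Finset (Fin n))) :
    circuitIdeal K C = monomialIdeal K (sqfreeExp '' (C : Set (Finset (Fin n)))) := by
  rw [circuitIdeal, monomialIdeal, Set.image_image]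
  simp only [sqfreeExp, monomial_sum_one]
  rfl

theorem sum_lt_sum_of_forall_sdiff_lt {F G : Finset (Fin n)} (hcard : F.card = G.card)
    (hne : F ≠ G) (h : ∀ g ∈ G \ F, ∀ i ∈ F, i < g) :
    ∑ i ∈ F, (i : ℕ) < ∑ i ∈ G, (i : ℕ) := by
  have hcard' : (F \ G).card = (G \ F).card := by
    have h1 := Finset.card_sdiff_add_card_inter F G
    have h2 := Finset.card_sdiff_add_card_inter G F
    rw [Finset.inter_comm] at h2
    omega
  have hFG : (F \ G).Nonempty := by
    rw [Finset.sdiff_nonempty]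
    exact fun hsub => hne (Finset.eq_of_subset_of_card_le hsub hcard.ge)
  obtain ⟨M, hM, hMmax⟩ := Finset.exists_max_image (F \ G) (fun i => (i : ℕ)) hFG
  have h1 : ∑ i ∈ F \ G, (i : ℕ) ≤ (F \ G).card • (M : ℕ) :=
    Finset.sum_le_card_nsmul _ _ _ hMmax
  have h2 : (G \ F).card • ((M : ℕ) + 1) ≤ ∑ i ∈ G \ F, (i : ℕ) :=
    Finset.card_nsmul_le_sum _ _ _ fun g hg => h g hg M (Finset.mem_sdiff.1 hM).1
  have h3 := Finset.sum_inter_add_sum_sdiff F G fun i => (i : ℕ)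
  have h4 := Finset.sum_inter_add_sum_sdiff G F fun i => (i : ℕ)
  rw [Finset.inter_comm] at h4
  have h5 := hFG.card_pos
  rw [← hcard', smul_eq_mul, mul_add] at h2
  rw [smul_eq_mul] at h1
  omega

/-- Squarefree stable ideals generated in one degree have a linear resolution. -/
theorem isLinearMonomial_of_shifted (d : ℕ) (𝓕 : Finset (Finset (Fin n)))
    (hcard : ∀ F ∈ 𝓕, F.card = d)
    (hshift : ∀ F ∈ 𝓕, ∀ i ∈ F, ∀ j < i, j ∉ F → insert j (F.erase i) ∈ 𝓕) :
    IsLinearMonomial K d (sqfreeExp '' (𝓕 : Set (Finset (Fin n)))) := by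
  induction 𝓕 using Finset.strongInduction with
  | H 𝓕 ih =>
  rcases 𝓕.eq_empty_or_nonempty with rfl | hne
  · rw [Finset.coe_empty, Set.image_empty]
    exact isLinearMonomial_empty _
  obtain ⟨F, hF, hFmax⟩ := Finset.exists_max_image 𝓕 (fun F => ∑ i ∈ F, (i : ℕ)) hne
  have herase : IsLinearMonomial K d (sqfreeExp '' (𝓕.erase F : Set (Finset (Fin n)))) := by
    refine ih _ (Finset.erase_ssubset hF) (fun G hG => hcard G (Finset.mem_of_mem_erase hG)) ?_
    intro G hG i hi j hji hj
    have hG' := Finset.mem_of_mem_erase hG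
    refine Finset.mem_erase.2 ⟨fun hGF => ?_, hshift G hG' i hi j hji hj⟩
    have h1 := hFmax G hG'
    have h2 := Finset.add_sum_erase G (fun i => (i : ℕ)) hi
    rw [← hGF, Finset.sum_insert fun h => hj (Finset.mem_of_mem_erase h)] at h1
    have h3 : (j : ℕ) < i := hji
    omega
  rw [← Finset.insert_erase hF, Finset.coe_insert, Set.image_insert_eq]
  refine IsLinearMonomial.insert ((degree_sqfreeExp F).trans (hcard F hF)) (fun m => ?_) herase
    (isLinearMonomial_variables (Finset.univ.filter fun t => t ∉ F ∧ ∃ i ∈ F, t < i)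
      (map_zero _))
  simp only [Set.exists_mem_image, Finset.mem_coe, zero_add, sqfreeExp_le_iff,
    support_add_sqfreeExp, Finsupp.single_le_iff, Finset.mem_filter, Finset.mem_univ, true_and,
    Nat.one_le_iff_ne_zero, ← Finsupp.mem_support_iff]
  constructor
  · rintro ⟨G, hG, hGm⟩
    by_contra! hcon
    obtain ⟨hGF, hG𝓕⟩ := Finset.mem_erase.1 hG
    refine (hFmax G hG𝓕).not_gt (sum_lt_sum_of_forall_sdiff_lt
      ((hcard F hF).trans (hcard G hG𝓕).symm) hGF.symm fun g hg i hi => ?_)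
    rw [Finset.mem_sdiff] at hg
    refine lt_of_le_of_ne (not_lt.1 fun hgi => ?_) fun h => hg.2 (h ▸ hi)
    exact hcon g ⟨hg.2, i, hi, hgi⟩ ((Finset.mem_union.1 (hGm hg.1)).resolve_right hg.2)
  · rintro ⟨t, ⟨htF, i, hi, hti⟩, htm⟩
    refine ⟨insert t (F.erase i), Finset.mem_erase.2 ⟨fun h => htF ?_,
      hshift F hF i hi t hti htF⟩, ?_⟩
    · exact h ▸ Finset.mem_insert_self _ _
    · exact Finset.insert_subset (Finset.mem_union_left _ htm)
        ((Finset.erase_subset _ _).trans Finset.subset_union_right)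

theorem mem_clutterCompl {d : ℕ} {C : Finset (Finset (Fin n))} {F : Finset (Fin n)} :
    F ∈ clutterCompl d C ↔ F.card = d ∧ F ∉ C := by
  simp [clutterCompl]

theorem isLinearMonomial_clutterCompl {C : Finset (Finset (Fin n))} (h : ReducibleToEmpty C) :
    IsLinearMonomial K 3 (sqfreeExp '' (clutterCompl 3 C : Set (Finset (Fin n)))) := by
  induction h with
  | empty =>
    refine isLinearMonomial_of_shifted 3 _ (fun F hF => (mem_clutterCompl.1 hF).1) ?_
    intro F hF i hi j _ hj
    rw [mem_clutterCompl] at hF ⊢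
    refine ⟨?_, Finset.notMem_empty _⟩
    rw [Finset.card_insert_of_notMem fun h => hj (Finset.mem_of_mem_erase h),
      Finset.card_erase_add_one hi, hF.1]
  | step C e he _ ih =>
    obtain ⟨hcard, -, hclique⟩ := he
    set N := e ∪ Finset.univ.filter fun c => insert c e ∈ C
    have hdeg : (sqfreeExp e).degree = 2 := (degree_sqfreeExp e).trans hcard
    have hstar : ∀ T : Finset (Fin n), Disjoint e T → ∀ m : Fin n →₀ ℕ,
        (∃ a ∈ (fun t => sqfreeExp e + Finsupp.single t 1) '' (T : Set (Fin n)), a ≤ m) ↔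
          ∃ c ∈ T, insert c e ⊆ m.support := by
      intro T hT m
      simp only [Set.exists_mem_image, Finset.mem_coe]
      refine exists_congr fun c => and_congr_right fun hc => ?_
      rw [sqfreeExp_add_single (Finset.disjoint_right.1 hT hc), sqfreeExp_le_iff]
    have hcompl : ∀ c ∉ e, (insert c e).card = 3 := fun c hc => by
      rw [Finset.card_insert_of_notMem hc, hcard]
    refine IsLinearMonomial.of_union_of_inter (fun m => ?_) (fun m => ?_)
      (isLinearMonomial_variables eᶜ hdeg) ih (isLinearMonomial_variables Nᶜ hdeg)
    · rw [hstar _ disjoint_compl_right]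
      simp only [Set.exists_mem_image, Finset.mem_coe, sqfreeExp_le_iff, mem_clutterCompl,
        Finset.mem_filter, Finset.mem_compl]
      constructor
      · rintro (⟨F, ⟨hF, hFC⟩, hm⟩ | ⟨c, hc, hm⟩)
        · exact ⟨F, ⟨hF, fun h => hFC h.1⟩, hm⟩
        · exact ⟨insert c e, ⟨hcompl c hc, fun h => h.2 (Finset.subset_insert _ _)⟩, hm⟩
      · rintro ⟨F, ⟨hF, hFD⟩, hm⟩
        by_cases hFC : F ∈ C
        · have heF : e ⊆ F := by
            by_contra heF
            exact hFD ⟨hFC, heF⟩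
          obtain ⟨c, hcF, hce⟩ := Finset.exists_mem_notMem_of_card_lt_card
            (show e.card < F.card by omega)
          exact Or.inr ⟨c, hce, (Finset.insert_subset hcF heF).trans hm⟩
        · exact Or.inl ⟨F, ⟨hF, hFC⟩, hm⟩
    · rw [hstar _ disjoint_compl_right, hstar _ (Finset.disjoint_left.2 fun i hi hi' =>
        Finset.mem_compl.1 hi' (Finset.mem_union_left _ hi))]
      simp only [Set.exists_mem_image, Finset.mem_coe, sqfreeExp_le_iff, mem_clutterCompl,
        Finset.mem_compl]
      constructor
      · rintro ⟨⟨F, ⟨hF, hFC⟩, hm⟩, c, hc, hcm⟩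
        have hFN : ¬ F ⊆ N := fun h => hFC (hclique F h hF)
        obtain ⟨x, hxF, hxN⟩ := Finset.not_subset.1 hFN
        exact ⟨x, hxN, Finset.insert_subset (hm hxF) ((Finset.subset_insert _ _).trans hcm)⟩
      · rintro ⟨x, hxN, hm⟩
        rw [Finset.mem_union, not_or, Finset.mem_filter] at hxN
        exact ⟨⟨insert x e, ⟨hcompl x hxN.1, fun h => hxN.2 ⟨Finset.mem_univ _, h⟩⟩, hm⟩,
          x, hxN.1, hm⟩

end Clutters

/-- If a 3-uniform clutter `C` on `[n]` can be transformed to the empty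
clutter by a finite sequence of deletions of simplicial edges, then the circuit ideal
`I(C̄)` has a 3-linear resolution over any field `K`. -/
theorem reducible_clutter_linear {K : Type*} [Field K] (n : ℕ)
    (C : Finset (Finset (Fin n))) (hunif : ∀ F ∈ C, F.card = 3)
    (hred : ReducibleToEmpty C) :
    HasLinearResolution 3 (circuitIdeal K (clutterCompl 3 C)) := by
  rw [circuitIdeal_eq_monomialIdeal]
  exact (isLinearMonomial_clutterCompl hred).hasLinearResolution
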